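/- Let p, q ≥ 1 be integers and let L be the (p+q) × (p+q) real block matrix L = [[A, C], [Cᵀ, B]], where A is the p × p matrix with every diagonal entry equal to p + q − 1 and every off-diagonal entry equal to −1, C is the p × q matrix all of whose entries are −1, and B = p·I_q is p times the q × q identity matrix. Then the characteristic polynomial of L is x·(x − (p + q))^p·(x − p)^{q−1}; equivalently, the eigenvalues of L are 0 with multiplicity 1, p + q with multiplicity p, and p with multiplicity q − 1. -/

import Mathlib

open Polynomial

/-- For `p, q ≥ 1`, the block matrix `L = [[A, C], [Cᵀ, B]]` — where `A` is `p × p` with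
diagonal entries `p + q - 1` and off-diagonal entries `-1`, `C` is the all-`(-1)` matrix of
size `p × q`, and `B = p·I_q` — has characteristic polynomial
`x (x - (p + q))^p (x - p)^(q-1)`. -/
theorem charpoly_block_matrix (p q : ℕ) (hp : 1 ≤ p) (hq : 1 ≤ q)
    (L : Matrix (Fin p ⊕ Fin q) (Fin p ⊕ Fin q) ℝ)
    (hL : L = Matrix.fromBlocks
      (Matrix.of fun i j : Fin p => if i = j then ((p : ℝ) + q - 1) else -1)
      (Matrix.of fun (_ : Fin p) (_ : Fin q) => (-1 : ℝ))
      (Matrix.of fun (_ : Fin q) (_ : Fin p) => (-1 : ℝ))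
      ((p : ℝ) • (1 : Matrix (Fin q) (Fin q) ℝ))) :
    L.charpoly = X * (X - C ((p : ℝ) + q)) ^ p * (X - C (p : ℝ)) ^ (q - 1) := by
  subst hL
  apply Polynomial.eq_of_infinite_eval_eq
  refine Set.Infinite.mono (s := {(p : ℝ)}ᶜ) ?_ (Set.Finite.infinite_compl (Set.finite_singleton _))
  intro x hx
  have hx' : x - p ≠ 0 := sub_ne_zero.mpr hx
  obtain ⟨m, rfl⟩ : ∃ m, q = m + 1 := ⟨q - 1, by omega⟩
  obtain ⟨k, rfl⟩ : ∃ k, p = k + 1 := ⟨p - 1, by omega⟩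
  simp only [Set.mem_setOf_eq]
  rw [Matrix.eval_charpoly]
  set P : ℝ := ((k + 1 : ℕ) : ℝ) with hP
  set Q : ℝ := ((m + 1 : ℕ) : ℝ) with hQ
  have h1 : Matrix.scalar (Fin (k+1) ⊕ Fin (m+1)) x - Matrix.fromBlocks
      (Matrix.of fun i j : Fin (k+1) => if i = j then (P + Q - 1) else -1)
      (Matrix.of fun (_ : Fin (k+1)) (_ : Fin (m+1)) => (-1 : ℝ))
      (Matrix.of fun (_ : Fin (m+1)) (_ : Fin (k+1)) => (-1 : ℝ))
      (P • (1 : Matrix (Fin (m+1)) (Fin (m+1)) ℝ)) =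
      Matrix.fromBlocks
      (Matrix.of fun i j : Fin (k+1) => if i = j then (x - (P + Q) + 1) else 1)
      (Matrix.of fun (_ : Fin (k+1)) (_ : Fin (m+1)) => (1 : ℝ))
      (Matrix.of fun (_ : Fin (m+1)) (_ : Fin (k+1)) => (1 : ℝ))
      ((x - P) • (1 : Matrix (Fin (m+1)) (Fin (m+1)) ℝ)) := by
    ext i j
    rcases i with i | i <;> rcases j with j | j
    · by_cases h : i = j
      · simp [h]; ring
      · simp [h]
    · simp
    · simp
    · by_cases h : i = j
      · simp [h]
      · simp [h]
  rw [h1]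
  let D : Matrix (Fin (m+1)) (Fin (m+1)) ℝ := (x - P) • 1
  letI : Invertible D := ⟨(x - P)⁻¹ • 1, by simp [D, smul_smul, hx'], by simp [D, smul_smul, hx']⟩
  have hinv : ⅟D = (x - P)⁻¹ • (1 : Matrix (Fin (m+1)) (Fin (m+1)) ℝ) := rfl
  rw [show (x - P) • (1 : Matrix (Fin (m+1)) (Fin (m+1)) ℝ) = D from rfl,
    Matrix.det_fromBlocks₂₂, hinv]
  have h2 : (Matrix.of fun i j : Fin (k+1) => if i = j then (x - (P + Q) + 1) else 1) -
      (Matrix.of fun (_ : Fin (k+1)) (_ : Fin (m+1)) => (1 : ℝ)) *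
      ((x - P)⁻¹ • (1 : Matrix (Fin (m+1)) (Fin (m+1)) ℝ)) *
      (Matrix.of fun (_ : Fin (m+1)) (_ : Fin (k+1)) => (1 : ℝ)) =
      Matrix.scalar (Fin (k+1)) (x - (P + Q)) -
        Matrix.vecMulVec (fun _ => Q * (x - P)⁻¹ - 1) (fun _ => 1) := by
    ext i j
    by_cases h : i = j
    · simp [h, Matrix.mul_apply, Matrix.vecMulVec_apply, hQ]; ring
    · simp [h, Matrix.mul_apply, Matrix.vecMulVec_apply, hQ]
  rw [h2, ← Matrix.eval_charpoly, Matrix.charpoly_vecMulVec]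
  simp only [D, Matrix.det_smul, Matrix.det_one, Fintype.card_fin, dotProduct,
    Finset.sum_const, Finset.card_univ, nsmul_eq_mul, Polynomial.eval_mul, Polynomial.eval_sub,
    Polynomial.eval_pow, Polynomial.eval_X, Polynomial.eval_C, Nat.add_sub_cancel, mul_one,
    Polynomial.eval_smul, smul_eq_mul]
  rw [← hP]
  field_simp
  ring
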